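/- Let s ∈ (0,1), σ ∈ (−1,1), n ≥ 3 and θ ∈ (0,π). With H = {x ∈ ℝⁿ : x_n > 0}, J_θ = {x ∈ ℝⁿ : x_n > 0 and (cos α) x_n = (sin α) x_1 for some α ∈ (0,θ)}, e(θ) = (cos θ) e₁ + (sin θ) e_n, and with H⁽²⁾, J_θ⁽²⁾, e⁽²⁾(θ) the corresponding objects in ℝ² (i.e. H⁽²⁾ = {x ∈ ℝ² : x₂ > 0}, J_θ⁽²⁾ = {x ∈ ℝ² : x₂ > 0 and (cos α) x₂ = (sin α) x₁ for some α ∈ (0,θ)}, e⁽²⁾(θ) = (cos θ, sin θ)), the following are equivalent: (i) lim_{ρ→0⁺} ∫_{{z ∈ ℝⁿ : |z−e(θ)|>ρ}} (1_{H∖J_θ}(z) + σ 1_{ℝⁿ∖H}(z) − 1_{J_θ}(z)) |e(θ)−z|^{−(n+s)} dz = 0; (ii) lim_{ρ→0⁺} ∫_{{z ∈ ℝ² : |z−e⁽²⁾(θ)|>ρ}} (1_{H⁽²⁾∖J_θ⁽²⁾}(z) + σ 1_{ℝ²∖H⁽²⁾}(z) − 1_{J_θ⁽²⁾}(z)) |e⁽²⁾(θ)−z|^{−(2+s)}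 dz = 0. In particular the contact angle θ(s,σ) determined by this equation does not depend on the dimension n. -/

import Mathlib

open MeasureTheory Filter Metric
open scoped ENNReal NNReal Topology

/-- The upper half space `H = {x ∈ ℝⁿ : x_n > 0}`. -/
def Hset (n : ℕ) (hn : 2 ≤ n) : Set (EuclideanSpace ℝ (Fin n)) :=
  {x | 0 < x ⟨n - 1, by omega⟩}

/-- The cone `J_θ = {x : x_n > 0 and cos α · x_n = sin α · x_1 for some α ∈ (0,θ)}`. -/
def Jset (n : ℕ) (hn : 2 ≤ n) (θ : ℝ) : Set (EuclideanSpace ℝ (Fin n)) :=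
  {x | 0 < x ⟨n - 1, by omega⟩ ∧ ∃ α ∈ Set.Ioo 0 θ,
    Real.cos α * x ⟨n - 1, by omega⟩ = Real.sin α * x ⟨0, by omega⟩}

/-- The point `e(θ) = cos θ e₁ + sin θ e_n`. -/
noncomputable def ePt (n : ℕ) (hn : 2 ≤ n) (θ : ℝ) : EuclideanSpace ℝ (Fin n) :=
  Real.cos θ • EuclideanSpace.single ⟨0, by omega⟩ (1 : ℝ)
    + Real.sin θ • EuclideanSpace.single ⟨n - 1, by omega⟩ (1 : ℝ)

/-- The nonlocal Young's law equation for the angle `θ`: the principal value of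
`∫ (1_{H∖J_θ} + σ 1_{Hᶜ} − 1_{J_θ})(z) |e(θ)−z|^{-(n+s)} dz` vanishes. -/
def YoungPV (n : ℕ) (hn : 2 ≤ n) (s σ θ : ℝ) : Prop :=
  Tendsto (fun ρ : ℝ => ∫ z in {z | ρ < dist z (ePt n hn θ)},
      (Set.indicator (Hset n hn \ Jset n hn θ) (fun _ => (1 : ℝ)) z
        + σ * Set.indicator (Hset n hn)ᶜ (fun _ => (1 : ℝ)) z
        - Set.indicator (Jset n hn θ) (fun _ => (1 : ℝ)) z)
      * ‖ePt n hn θ - z‖ ^ (-((n : ℝ) + s)))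
    (𝓝[>] (0 : ℝ)) (nhds 0)

/-- The weight `1_{H∖J_θ} + σ 1_{Hᶜ} − 1_{J_θ}` as a function of the coordinates
`a = z₁` and `b = z_n`. -/
noncomputable def planeWeight (σ θ a b : ℝ) : ℝ :=
  if 0 < b then (if Real.cos θ * b < Real.sin θ * a then -1 else 1) else σ

/-- The sum of the weight over the two points `e(θ) ± q`. -/
noncomputable def symWeight (σ θ : ℝ) (q : ℝ × ℝ) : ℝ :=
  planeWeight σ θ (Real.cos θ + q.1) (Real.sin θ + q.2)
    + planeWeight σ θ (Real.cos θ + -q.1) (Real.sin θ + -q.2)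

/-- For `b > 0`, the polar angle of `(a, b)` lies in `(0, θ)` iff `(a, b)` lies strictly on the
clockwise side of the line of angle `θ`. -/
lemma exists_angle_iff {θ a b : ℝ} (hθ : θ ∈ Set.Ioo 0 Real.pi) (hb : 0 < b) :
    (∃ α ∈ Set.Ioo 0 θ, Real.cos α * b = Real.sin α * a) ↔
      Real.cos θ * b < Real.sin θ * a := by
  constructor
  · rintro ⟨α, ⟨h0, h1⟩, h⟩
    have hs : 0 < Real.sin α := Real.sin_pos_of_pos_of_lt_pi h0 (h1.trans hθ.2)
    have hd : 0 < Real.sin (θ - α) :=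
      Real.sin_pos_of_pos_of_lt_pi (by linarith) (by linarith [hθ.2])
    rw [Real.sin_sub] at hd
    have h2 := mul_pos hb hd
    refine lt_of_mul_lt_mul_left ?_ hs.le
    linear_combination h2 + Real.sin θ * h
  · intro h
    set z : ℂ := ⟨a, b⟩ with hz
    have hz0 : z ≠ 0 := fun h0 => hb.ne' (congrArg Complex.im h0)
    have hr : 0 < ‖z‖ := norm_pos_iff.2 hz0
    have ha : ‖z‖ * Real.cos z.arg = a := Complex.norm_mul_cos_arg z
    have hb' : ‖z‖ * Real.sin z.arg = b := Complex.norm_mul_sin_arg z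
    have hs : 0 < Real.sin z.arg := by
      by_contra hcon
      nlinarith
    have h0 : 0 < z.arg := by
      by_contra! hcon
      linarith [Real.sin_nonpos_of_nonpos_of_neg_pi_le hcon (Complex.neg_pi_lt_arg z).le]
    refine ⟨z.arg, ⟨h0, ?_⟩, ?_⟩
    · by_contra! hcon
      have h1 : Real.sin (θ - z.arg) ≤ 0 :=
        Real.sin_nonpos_of_nonpos_of_neg_pi_le (by linarith)
          (by linarith [Complex.arg_le_pi z, hθ.1])
      rw [Real.sin_sub] at h1
      rw [← ha, ← hb'] at h
      nlinarith
    · rw [← ha, ← hb']; ring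

lemma weight_eq_planeWeight (m : ℕ) (hn : 2 ≤ m + 2) {σ θ : ℝ} (hθ : θ ∈ Set.Ioo 0 Real.pi)
    (z : EuclideanSpace ℝ (Fin (m + 2))) :
    Set.indicator (Hset (m + 2) hn \ Jset (m + 2) hn θ) (fun _ => (1 : ℝ)) z
        + σ * Set.indicator (Hset (m + 2) hn)ᶜ (fun _ => (1 : ℝ)) z
        - Set.indicator (Jset (m + 2) hn θ) (fun _ => (1 : ℝ)) z
      = planeWeight σ θ (z 0) (z (Fin.last (m + 1))) := by
  have hH : z ∈ Hset (m + 2) hn ↔ 0 < z (Fin.last (m + 1)) := Iff.rfl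
  have hJ : z ∈ Jset (m + 2) hn θ ↔ 0 < z (Fin.last (m + 1)) ∧
      Real.cos θ * z (Fin.last (m + 1)) < Real.sin θ * z 0 :=
    and_congr_right fun hb => exists_angle_iff hθ hb
  by_cases hb : 0 < z (Fin.last (m + 1)) <;>
    by_cases hc : Real.cos θ * z (Fin.last (m + 1)) < Real.sin θ * z 0 <;>
    simp [planeWeight, hH, hJ, hb, hc]

lemma measurable_planeWeight (σ θ : ℝ) :
    Measurable fun q : ℝ × ℝ => planeWeight σ θ q.1 q.2 := by
  unfold planeWeight
  refine Measurable.ite (measurableSet_lt (by fun_prop) (by fun_prop)) ?_ (by fun_prop)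
  exact Measurable.ite (measurableSet_lt (by fun_prop) (by fun_prop)) (by fun_prop) (by fun_prop)

lemma measurable_symWeight (σ θ : ℝ) : Measurable (symWeight σ θ) := by
  have h := measurable_planeWeight σ θ
  exact (h.comp (g := fun q : ℝ × ℝ => planeWeight σ θ q.1 q.2)
      (f := fun q : ℝ × ℝ => (Real.cos θ + q.1, Real.sin θ + q.2)) (by fun_prop)).add
    (h.comp (g := fun q : ℝ × ℝ => planeWeight σ θ q.1 q.2)
      (f := fun q : ℝ × ℝ => (Real.cos θ + -q.1, Real.sin θ + -q.2)) (by fun_prop))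

lemma abs_planeWeight_le {σ : ℝ} (hσ : σ ∈ Set.Ioo (-1 : ℝ) 1) (θ a b : ℝ) :
    |planeWeight σ θ a b| ≤ 1 := by
  unfold planeWeight
  split_ifs
  · simp
  · simp
  · exact abs_le.2 ⟨hσ.1.le, hσ.2.le⟩

/-- Near `e(θ)` the weights of points symmetric about `e(θ)` cancel. -/
lemma symWeight_eq_zero (σ : ℝ) {θ : ℝ} {q : ℝ × ℝ} (hq : |q.2| < Real.sin θ)
    (hline : Real.cos θ * q.2 - Real.sin θ * q.1 ≠ 0) : symWeight σ θ q = 0 := by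
  obtain ⟨h1, h2⟩ := abs_lt.1 hq
  have hp : 0 < Real.sin θ + q.2 := by linarith
  have hm : 0 < Real.sin θ + -q.2 := by linarith
  unfold symWeight planeWeight
  rw [if_pos hp, if_pos hm]
  rcases lt_or_gt_of_ne hline with h | h
  · rw [if_pos (by linarith), if_neg (by linarith)]; norm_num
  · rw [if_neg (by linarith), if_pos (by linarith)]; norm_num

lemma ae_line_ne_zero (m : ℕ) {θ : ℝ} (hs : 0 < Real.sin θ) :
    ∀ᵐ w : EuclideanSpace ℝ (Fin (m + 2)),
      Real.cos θ * w (Fin.last (m + 1)) - Real.sin θ * w 0 ≠ 0 := by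
  let f : EuclideanSpace ℝ (Fin (m + 2)) →ₗ[ℝ] ℝ :=
    Real.cos θ • (EuclideanSpace.proj (Fin.last (m + 1))).toLinearMap
      - Real.sin θ • (EuclideanSpace.proj 0).toLinearMap
  have hf : LinearMap.ker f ≠ ⊤ := by
    intro h
    have h1 : EuclideanSpace.single (0 : Fin (m + 2)) (1 : ℝ) ∈ LinearMap.ker f := by
      rw [h]; trivial
    have h2 : Real.cos θ * EuclideanSpace.single (0 : Fin (m + 2)) (1 : ℝ) (Fin.last (m + 1))
      - Real.sin θ * EuclideanSpace.single (0 : Fin (m + 2)) (1 : ℝ) 0 = 0 := h1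
    simp [Fin.ext_iff] at h2
    exact hs.ne' h2
  have h := Measure.addHaar_submodule volume (LinearMap.ker f) hf
  rw [ae_iff]
  convert h using 2
  ext w
  simp [f]

/-- Away from the origin the kernel `‖w‖ ^ (-p)` is integrable when `p` exceeds the dimension. -/
lemma integrable_indicator_norm_rpow {E : Type*} [NormedAddCommGroup E] [NormedSpace ℝ E]
    [FiniteDimensional ℝ E] [MeasurableSpace E] [BorelSpace E] (μ : Measure E)
    [μ.IsAddHaarMeasure] {p ρ : ℝ} (hp : (Module.finrank ℝ E : ℝ) < p) (hρ : 0 < ρ) :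
    Integrable (Set.indicator {w : E | ρ < ‖w‖} fun w => ‖w‖ ^ (-p)) μ := by
  have hp0 : 0 ≤ p := (Nat.cast_nonneg _).trans hp.le
  refine ((integrable_one_add_norm (μ := μ) hp).const_mul ((ρ / (1 + ρ)) ^ (-p))).mono' ?_ ?_
  · exact (Measurable.indicator (by fun_prop)
      (measurableSet_lt (by fun_prop) (by fun_prop))).aestronglyMeasurable
  · refine Eventually.of_forall fun w => ?_
    by_cases hw : ρ < ‖w‖
    · rw [Set.indicator_of_mem (by exact hw), Real.norm_of_nonneg (by positivity),
        ← Real.mul_rpow (by positivity) (by positivity)]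
      refine Real.rpow_le_rpow_of_nonpos (by positivity) ?_ (by linarith)
      rw [div_mul_eq_mul_div, div_le_iff₀ (by positivity)]
      nlinarith
    · rw [Set.indicator_of_notMem (by exact hw), norm_zero]
      positivity

/-- The weight is bounded by `2` after symmetrization. -/
lemma abs_symWeight_le {σ : ℝ} (hσ : σ ∈ Set.Ioo (-1 : ℝ) 1) (θ : ℝ) (q : ℝ × ℝ) :
    |symWeight σ θ q| ≤ 2 := by
  unfold symWeight
  refine (abs_add_le _ _).trans ?_
  linarith [abs_planeWeight_le hσ θ (Real.cos θ + q.1) (Real.sin θ + q.2),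
    abs_planeWeight_le hσ θ (Real.cos θ + -q.1) (Real.sin θ + -q.2)]

/-- The symmetrized integrand in dimension `m + 2`. -/
noncomputable def symIntegrand (m : ℕ) (σ θ p : ℝ) (w : EuclideanSpace ℝ (Fin (m + 2))) : ℝ :=
  symWeight σ θ (w 0, w (Fin.last (m + 1))) * ‖w‖ ^ (-p)

lemma indicator_symIntegrand_ae_eq (m : ℕ) (σ p : ℝ) {θ ρ : ℝ} (hs : 0 < Real.sin θ)
    (hρ : ρ < Real.sin θ) :
    Set.indicator {w | ρ < ‖w‖} (symIntegrand m σ θ p) =ᵐ[volume] symIntegrand m σ θ p := by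
  filter_upwards [ae_line_ne_zero m hs] with w hw
  by_cases h : ρ < ‖w‖
  · rw [Set.indicator_of_mem (by exact h)]
  · rw [Set.indicator_of_notMem (by exact h), symIntegrand, symWeight_eq_zero, zero_mul]
    · exact (PiLp.norm_apply_le w (Fin.last (m + 1))).trans_lt (by linarith)
    · exact hw

lemma integrable_symIntegrand (m : ℕ) {σ θ p : ℝ} (hσ : σ ∈ Set.Ioo (-1 : ℝ) 1)
    (hs : 0 < Real.sin θ) (hp : ((m + 2 : ℕ) : ℝ) < p) :
    Integrable (symIntegrand m σ θ p) := by
  refine Integrable.congr ?_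
    (indicator_symIntegrand_ae_eq m σ p hs (by linarith : Real.sin θ / 2 < Real.sin θ))
  have hK := integrable_indicator_norm_rpow (volume : Measure (EuclideanSpace ℝ (Fin (m + 2))))
    (p := p) (by simpa using hp) (half_pos hs)
  have hG : Measurable fun w : EuclideanSpace ℝ (Fin (m + 2)) =>
      symWeight σ θ (w 0, w (Fin.last (m + 1))) :=
    (measurable_symWeight σ θ).comp (by fun_prop)
  have := hK.bdd_mul (c := 2) hG.aestronglyMeasurable
    (Eventually.of_forall fun w => abs_symWeight_le hσ θ _)
  refine this.congr (Eventually.of_forall fun w => ?_)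
  by_cases h : Real.sin θ / 2 < ‖w‖ <;> simp [h, symIntegrand]

lemma ePt_apply_zero (m : ℕ) (hn : 2 ≤ m + 2) (θ : ℝ) : ePt (m + 2) hn θ 0 = Real.cos θ := by
  simp [ePt, Fin.ext_iff]

lemma ePt_apply_last (m : ℕ) (hn : 2 ≤ m + 2) (θ : ℝ) :
    ePt (m + 2) hn θ (Fin.last (m + 1)) = Real.sin θ := by
  have : (⟨m + 1, by omega⟩ : Fin (m + 2)) = Fin.last (m + 1) := rfl
  simp [ePt, Fin.ext_iff, this]

/-- For small radii, twice the truncated integral is the full symmetrized integral. -/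
lemma two_mul_truncated_integral (m : ℕ) (hn : 2 ≤ m + 2) {σ θ p ρ : ℝ}
    (hσ : σ ∈ Set.Ioo (-1 : ℝ) 1) (hθ : θ ∈ Set.Ioo 0 Real.pi)
    (hp : ((m + 2 : ℕ) : ℝ) < p) (hρ0 : 0 < ρ) (hρ : ρ < Real.sin θ) :
    2 * ∫ z in {z | ρ < dist z (ePt (m + 2) hn θ)},
        (Set.indicator (Hset (m + 2) hn \ Jset (m + 2) hn θ) (fun _ => (1 : ℝ)) z
          + σ * Set.indicator (Hset (m + 2) hn)ᶜ (fun _ => (1 : ℝ)) z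
          - Set.indicator (Jset (m + 2) hn θ) (fun _ => (1 : ℝ)) z)
        * ‖ePt (m + 2) hn θ - z‖ ^ (-p)
      = ∫ w, symIntegrand m σ θ p w := by
  have hs : 0 < Real.sin θ := hρ0.trans hρ
  simp only [weight_eq_planeWeight m hn hθ]
  set e := ePt (m + 2) hn θ with he
  let F : EuclideanSpace ℝ (Fin (m + 2)) → ℝ := Set.indicator {w | ρ < ‖w‖} fun w =>
    planeWeight σ θ (Real.cos θ + w 0) (Real.sin θ + w (Fin.last (m + 1))) * ‖w‖ ^ (-p)
  have hF : Integrable F := by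
    have hK := integrable_indicator_norm_rpow (volume : Measure (EuclideanSpace ℝ (Fin (m + 2))))
      (p := p) (by simpa using hp) hρ0
    have hG : Measurable fun w : EuclideanSpace ℝ (Fin (m + 2)) =>
        planeWeight σ θ (Real.cos θ + w 0) (Real.sin θ + w (Fin.last (m + 1))) :=
      (measurable_planeWeight σ θ).comp
        (f := fun w : EuclideanSpace ℝ (Fin (m + 2)) =>
          (Real.cos θ + w 0, Real.sin θ + w (Fin.last (m + 1)))) (by fun_prop)
    have := hK.bdd_mul (c := 1) hG.aestronglyMeasurable
      (Eventually.of_forall fun w => abs_planeWeight_le hσ θ _ _)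
    refine this.congr (Eventually.of_forall fun w => ?_)
    by_cases h : ρ < ‖w‖ <;> simp [h, F]
  have hshift : ∫ z in {z | ρ < dist z e},
      planeWeight σ θ (z 0) (z (Fin.last (m + 1))) * ‖e - z‖ ^ (-p) = ∫ w, F w := by
    rw [← integral_indicator (measurableSet_lt (by fun_prop) (by fun_prop)),
      ← integral_add_left_eq_self _ e]
    refine integral_congr_ae (Eventually.of_forall fun w => ?_)
    simp [F, Set.indicator_apply, he, ePt_apply_zero, ePt_apply_last]
  rw [hshift, two_mul]
  nth_rewrite 2 [← integral_neg_eq_self]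
  rw [← integral_add hF hF.comp_neg,
    ← integral_congr_ae (indicator_symIntegrand_ae_eq m σ p hs hρ)]
  refine integral_congr_ae (Eventually.of_forall fun w => ?_)
  by_cases h : ρ < ‖w‖ <;> simp [F, h, symIntegrand, symWeight, add_mul]

/-- The principal value equation is the vanishing of an absolutely convergent integral. -/
lemma youngPV_iff_integral_eq_zero (m : ℕ) (hn : 2 ≤ m + 2) {s σ θ : ℝ} (hs : 0 < s)
    (hσ : σ ∈ Set.Ioo (-1 : ℝ) 1) (hθ : θ ∈ Set.Ioo 0 Real.pi) :
    YoungPV (m + 2) hn s σ θ ↔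
      ∫ w, symIntegrand m σ θ (((m + 2 : ℕ) : ℝ) + s) w = 0 := by
  have hsin : 0 < Real.sin θ := Real.sin_pos_of_pos_of_lt_pi hθ.1 hθ.2
  have hev : ∀ᶠ ρ in 𝓝[>] (0 : ℝ), ρ ∈ Set.Ioo 0 (Real.sin θ) := Ioo_mem_nhdsGT hsin
  unfold YoungPV
  rw [tendsto_congr' (f₂ := fun _ => (∫ w, symIntegrand m σ θ (((m + 2 : ℕ) : ℝ) + s) w) / 2)
    (hev.mono fun ρ hρ => ?_), tendsto_const_nhds_iff]
  · simp
  · rw [← two_mul_truncated_integral m hn hσ hθ (by linarith) hρ.1 hρ.2]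
    ring

/-- Splitting off the first and the last coordinate of a Euclidean space. -/
noncomputable def splitFirstLast (m : ℕ) :
    EuclideanSpace ℝ (Fin (m + 2)) ≃ᵐ (ℝ × ℝ) × EuclideanSpace ℝ (Fin m) :=
  (MeasurableEquiv.toLp 2 (Fin (m + 2) → ℝ)).symm.trans <|
    (MeasurableEquiv.piFinSuccAbove (fun _ => ℝ) 0).trans <|
    ((MeasurableEquiv.refl ℝ).prodCongr
      (MeasurableEquiv.piFinSuccAbove (fun _ => ℝ) (Fin.last m))).trans <|
    MeasurableEquiv.prodAssoc.symm.trans <|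
    (MeasurableEquiv.refl (ℝ × ℝ)).prodCongr (MeasurableEquiv.toLp 2 (Fin m → ℝ))

lemma measurePreserving_splitFirstLast (m : ℕ) : MeasurePreserving (splitFirstLast m) :=
  (((MeasurePreserving.id volume).prod (PiLp.volume_preserving_toLp (Fin m))).comp
    volume_preserving_prodAssoc.symm).comp <|
  ((MeasurePreserving.id volume).prod
    (volume_preserving_piFinSuccAbove (fun _ => ℝ) (Fin.last m))).comp <|
  (volume_preserving_piFinSuccAbove (fun _ => ℝ) 0).comp <|
  PiLp.volume_preserving_ofLp (Fin (m + 2))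

lemma splitFirstLast_fst (m : ℕ) (w : EuclideanSpace ℝ (Fin (m + 2))) :
    (splitFirstLast m w).1 = (w 0, w (Fin.last (m + 1))) := rfl

lemma norm_eq_splitFirstLast (m : ℕ) (w : EuclideanSpace ℝ (Fin (m + 2))) :
    ‖w‖ = √((splitFirstLast m w).1.1 ^ 2 + (splitFirstLast m w).1.2 ^ 2
      + ‖(splitFirstLast m w).2‖ ^ 2) := by
  have h (i : Fin m) : (splitFirstLast m w).2 i = w i.castSucc.succ := by
    change w (Fin.succAbove 0 (Fin.succAbove (Fin.last m) i)) = _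
    simp
  rw [EuclideanSpace.norm_eq, EuclideanSpace.real_norm_sq_eq, Fin.sum_univ_succ,
    Fin.sum_univ_castSucc]
  simp only [h, splitFirstLast_fst, Real.norm_eq_abs, sq_abs, Fin.succ_last]
  congr 1
  ring

/-- Integrating the kernel over the fibre of dimension `m`. -/
lemma integral_fibre_kernel (m : ℕ) (p : ℝ) {R : ℝ} (hR : 0 < R) :
    ∫ y : EuclideanSpace ℝ (Fin m), √(R ^ 2 + ‖y‖ ^ 2) ^ (-p)
      = R ^ ((m : ℝ) - p) * ∫ y : EuclideanSpace ℝ (Fin m), √(1 + ‖y‖ ^ 2) ^ (-p) := by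
  have h := Measure.integral_comp_inv_smul (volume : Measure (EuclideanSpace ℝ (Fin m)))
    (fun y => √(1 + ‖y‖ ^ 2) ^ (-p)) R
  rw [finrank_euclideanSpace_fin, abs_of_pos (by positivity), smul_eq_mul] at h
  rw [Real.rpow_sub hR, Real.rpow_natCast, div_eq_mul_inv, mul_right_comm, ← h,
    ← Real.rpow_neg hR.le, ← integral_mul_const]
  refine integral_congr_ae (Eventually.of_forall fun y => ?_)
  dsimp only
  rw [← Real.mul_rpow (Real.sqrt_nonneg _) hR.le]
  congr 1
  nth_rewrite 3 [← Real.sqrt_sq hR.le]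
  rw [← Real.sqrt_mul (by positivity), norm_smul, norm_inv, Real.norm_of_nonneg hR.le]
  congr 1
  field_simp

lemma integral_fibre_kernel_pos (m : ℕ) {p : ℝ} (hp : (m : ℝ) < p) :
    0 < ∫ y : EuclideanSpace ℝ (Fin m), √(1 + ‖y‖ ^ 2) ^ (-p) := by
  have hpos (y : EuclideanSpace ℝ (Fin m)) : 0 < √(1 + ‖y‖ ^ 2) ^ (-p) := by positivity
  have hint : Integrable fun y : EuclideanSpace ℝ (Fin m) => √(1 + ‖y‖ ^ 2) ^ (-p) := by
    refine (integrable_rpow_neg_one_add_norm_sq (r := p) (by simpa using hp)).congr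
      (Eventually.of_forall fun y => ?_)
    exact Real.rpow_div_two_eq_sqrt _ (by positivity)
  rw [integral_pos_iff_support_of_nonneg (fun y => (hpos y).le) hint,
    Function.support_eq_univ fun y => (hpos y).ne']
  exact Measure.measure_univ_pos.2 (NeZero.ne _)

/-- The symmetrized integral in dimension `m + 2` is a multiple, independent of the weight,
of a planar integral. -/
lemma integral_symIntegrand (m : ℕ) {σ θ p : ℝ} (hσ : σ ∈ Set.Ioo (-1 : ℝ) 1)
    (hs : 0 < Real.sin θ) (hp : ((m + 2 : ℕ) : ℝ) < p) :
    ∫ w, symIntegrand m σ θ p w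
      = (∫ q : ℝ × ℝ, symWeight σ θ q * √(q.1 ^ 2 + q.2 ^ 2) ^ ((m : ℝ) - p))
        * ∫ y : EuclideanSpace ℝ (Fin m), √(1 + ‖y‖ ^ 2) ^ (-p) := by
  let F : (ℝ × ℝ) × EuclideanSpace ℝ (Fin m) → ℝ := fun x =>
    symWeight σ θ x.1 * √(x.1.1 ^ 2 + x.1.2 ^ 2 + ‖x.2‖ ^ 2) ^ (-p)
  have hF : symIntegrand m σ θ p = F ∘ splitFirstLast m := by
    ext w
    simp only [symIntegrand, F, Function.comp_apply]
    rw [← norm_eq_splitFirstLast, splitFirstLast_fst]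
  have hmp := measurePreserving_splitFirstLast m
  have hint : Integrable F := by
    rw [← hmp.integrable_comp_emb (splitFirstLast m).measurableEmbedding, ← hF]
    exact integrable_symIntegrand m hσ hs hp
  rw [hF]
  simp only [Function.comp_apply]
  rw [hmp.integral_comp', Measure.volume_eq_prod, integral_prod F hint, ← integral_mul_const]
  have hne : ∀ᵐ q : ℝ × ℝ, q ≠ 0 := by
    rw [ae_iff]; simp
  refine integral_congr_ae ?_
  filter_upwards [hne] with q hq
  have hpos : 0 < q.1 ^ 2 + q.2 ^ 2 := by
    by_contra! hcon
    exact hq (Prod.ext (by simp; nlinarith) (by simp; nlinarith))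
  have := integral_fibre_kernel m p (Real.sqrt_pos.2 hpos)
  rw [Real.sq_sqrt hpos.le] at this
  simp only [F]
  rw [integral_const_mul, this, mul_assoc]

/-- The principal value equation in terms of a planar integral independent of the dimension. -/
lemma youngPV_iff_planar_integral_eq_zero (m : ℕ) (hn : 2 ≤ m + 2) {s σ θ : ℝ} (hs : 0 < s)
    (hσ : σ ∈ Set.Ioo (-1 : ℝ) 1) (hθ : θ ∈ Set.Ioo 0 Real.pi) :
    YoungPV (m + 2) hn s σ θ ↔
      ∫ q : ℝ × ℝ, symWeight σ θ q * √(q.1 ^ 2 + q.2 ^ 2) ^ (-(2 + s)) = 0 := by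
  have hexp : (m : ℝ) - (((m + 2 : ℕ) : ℝ) + s) = -(2 + s) := by push_cast; ring
  have hpos := integral_fibre_kernel_pos m (p := ((m + 2 : ℕ) : ℝ) + s)
    (by push_cast; linarith)
  rw [youngPV_iff_integral_eq_zero m hn hs hσ hθ, integral_symIntegrand m hσ
    (Real.sin_pos_of_pos_of_lt_pi hθ.1 hθ.2) (by linarith), hexp, mul_eq_zero,
    or_iff_left hpos.ne']

/-- (The nonlocal Young's law equation is dimension-independent: the
`n`-dimensional principal-value equation holds iff the corresponding `2`-dimensional
one does; in particular the contact angle `θ(s,σ)` does not depend on `n`). -/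
theorem stmt6 (n : ℕ) (hn : 3 ≤ n) (s : ℝ) (hs : s ∈ Set.Ioo (0 : ℝ) 1)
    (σ : ℝ) (hσ : σ ∈ Set.Ioo (-1 : ℝ) 1) (θ : ℝ) (hθ : θ ∈ Set.Ioo 0 Real.pi) :
    YoungPV n (by omega) s σ θ ↔ YoungPV 2 (by omega) s σ θ := by
  obtain ⟨m, rfl⟩ : ∃ m, n = m + 2 := ⟨n - 2, by omega⟩
  exact (youngPV_iff_planar_integral_eq_zero m _ hs.1 hσ hθ).trans
    (youngPV_iff_planar_integral_eq_zero 0 le_rfl hs.1 hσ hθ).symm
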